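/- arXiv:2506.05214 — 7 statements merged into one kernel-verified Lean document; each statement's English description precedes it below -/
import Mathlib

section
/- Let (Ω, p) be a probability space, X : Ω → ℝ measurable, w : Ω → ℝ measurable with w(ω) ≥ 1 for all ω and ∫ w dp < ∞, and let M ∈ ℝ satisfy X ≤ M p-almost everywhere. Fix ε > 0 and suppose ρ_ε := p({ω : X(ω) > M − ε/2}) > 0. Then for every β ≥ 0, the tilted probability of the bad event satisfies q_β({ω : X(ω) < M − ε}) ≤ e^{−β·ε/2}·(∫ w dp)/ρ_ε. -/
open MeasureTheory Real

/-- With `q_β(A) = (∫_A exp(β·X)·w dp)/Z_β` the exponentially tilted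
probability measure, if `ρ_ε := p({X > M − ε/2}) > 0` then for every `β ≥ 0`,
`q_β({X < M − ε}) ≤ e^{−β·ε/2}·(∫ w dp)/ρ_ε`. -/
theorem stmt8 {Ω : Type*} [MeasurableSpace Ω] (p : Measure Ω) [IsProbabilityMeasure p]
    (X : Ω → ℝ) (hX : Measurable X) (w : Ω → ℝ) (hw : Measurable w)
    (hw1 : ∀ ω, 1 ≤ w ω) (hwInt : Integrable w p)
    (M : ℝ) (hXM : ∀ᵐ ω ∂p, X ω ≤ M)
    (ε : ℝ) (hε : 0 < ε) (hρ : 0 < (p {ω | M - ε / 2 < X ω}).toReal)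
    (β : ℝ) (hβ : 0 ≤ β) :
    (∫ ω in {ω | X ω < M - ε}, Real.exp (β * X ω) * w ω ∂p) /
        (∫ ω, Real.exp (β * X ω) * w ω ∂p) ≤
      Real.exp (-β * ε / 2) * (∫ ω, w ω ∂p) / (p {ω | M - ε / 2 < X ω}).toReal := by
  have hint : Integrable (fun ω => Real.exp (β * X ω) * w ω) p := by
    refine (hwInt.const_mul (Real.exp (β * M))).mono' (by fun_prop) ?_
    filter_upwards [hXM] with ω h
    have h1 := hw1 ω
    rw [Real.norm_of_nonneg (by positivity)]
    gcongr
  have hA : MeasurableSet {ω | X ω < M - ε} := measurableSet_lt hX measurable_const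
  have hB : MeasurableSet {ω | M - ε / 2 < X ω} := measurableSet_lt measurable_const hX
  have hnum : (∫ ω in {ω | X ω < M - ε}, Real.exp (β * X ω) * w ω ∂p) ≤
      Real.exp (β * (M - ε)) * ∫ ω, w ω ∂p := by
    rw [← integral_const_mul]
    refine (setIntegral_mono_on hint.integrableOn
      (hwInt.const_mul (Real.exp (β * (M - ε)))).integrableOn hA ?_).trans
      (setIntegral_le_integral (hwInt.const_mul _) ?_)
    · intro ω h
      have h1 := hw1 ω
      have h2 : X ω ≤ M - ε := le_of_lt h
      gcongr
    · filter_upwards with ω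
      have h1 := hw1 ω
      simp only [Pi.zero_apply]
      positivity
  have hden : Real.exp (β * (M - ε / 2)) * (p {ω | M - ε / 2 < X ω}).toReal ≤
      ∫ ω, Real.exp (β * X ω) * w ω ∂p := by
    have e : Real.exp (β * (M - ε / 2)) * (p {ω | M - ε / 2 < X ω}).toReal =
        ∫ ω in {ω | M - ε / 2 < X ω}, Real.exp (β * (M - ε / 2)) ∂p := by
      rw [setIntegral_const, smul_eq_mul, mul_comm]
      rfl
    rw [e]
    refine (setIntegral_mono_on (integrable_const _).integrableOn hint.integrableOn hB ?_).trans
      (setIntegral_le_integral hint ?_)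
    · intro ω h
      have h1 := hw1 ω
      have h2 : M - ε / 2 ≤ X ω := le_of_lt h
      calc Real.exp (β * (M - ε / 2)) ≤ Real.exp (β * X ω) := by gcongr
        _ ≤ _ := le_mul_of_one_le_right (Real.exp_pos _).le h1
    · filter_upwards with ω
      have h1 := hw1 ω
      simp only [Pi.zero_apply]
      positivity
  have hw0 : 0 ≤ ∫ ω, w ω ∂p := integral_nonneg fun ω => zero_le_one.trans (hw1 ω)
  have hexp : Real.exp (β * (M - ε)) =
      Real.exp (-β * ε / 2) * Real.exp (β * (M - ε / 2)) := by
    rw [← Real.exp_add]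
    ring_nf
  have hpos : 0 < Real.exp (β * (M - ε / 2)) * (p {ω | M - ε / 2 < X ω}).toReal :=
    mul_pos (Real.exp_pos _) hρ
  refine (div_le_div₀ (mul_nonneg (Real.exp_pos _).le hw0) hnum hpos hden).trans (le_of_eq ?_)
  rw [hexp, div_eq_div_iff hpos.ne' hρ.ne']
  ring
end

section
/- Let (Ω, p) be a probability space, X : Ω → ℝ measurable, w : Ω → ℝ measurable with w(ω) ≥ 1 for all ω and ∫ w dp < ∞, and let M ∈ ℝ satisfy X ≤ M p-almost everywhere. Fix ε > 0 and suppose p({ω : X(ω) > M − ε/2}) > 0. Then q_β({ω : X(ω) < M − ε}) → 0 as β → ∞. -/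
open MeasureTheory Real Filter

/-- With `q_β` the exponentially tilted probability measure, if
`p({X > M − ε/2}) > 0` then `q_β({X < M − ε}) → 0` as `β → ∞`. -/
theorem stmt9 {Ω : Type*} [MeasurableSpace Ω] (p : Measure Ω) [IsProbabilityMeasure p]
    (X : Ω → ℝ) (hX : Measurable X) (w : Ω → ℝ) (hw : Measurable w)
    (hw1 : ∀ ω, 1 ≤ w ω) (hwInt : Integrable w p)
    (M : ℝ) (hXM : ∀ᵐ ω ∂p, X ω ≤ M)
    (ε : ℝ) (hε : 0 < ε) (hρ : 0 < p {ω | M - ε / 2 < X ω}) :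
    Tendsto (fun β : ℝ =>
        (∫ ω in {ω | X ω < M - ε}, Real.exp (β * X ω) * w ω ∂p) /
          (∫ ω, Real.exp (β * X ω) * w ω ∂p))
      atTop (nhds 0) := by
  set A : Set Ω := {ω | X ω < M - ε} with hA
  set B : Set Ω := {ω | M - ε / 2 < X ω} with hB
  have mA : MeasurableSet A := measurableSet_lt hX measurable_const
  have mB : MeasurableSet B := measurableSet_lt measurable_const hX
  have hr : 0 < p.real B := ENNReal.toReal_pos hρ.ne' (measure_ne_top _ _)
  have hw0 : ∀ ω, 0 ≤ w ω := fun ω => zero_le_one.trans (hw1 ω)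
  have hnn : ∀ β ω, 0 ≤ Real.exp (β * X ω) * w ω :=
    fun β ω => mul_nonneg (Real.exp_pos _).le (hw0 ω)
  have hint : ∀ β : ℝ, 0 ≤ β → Integrable (fun ω => Real.exp (β * X ω) * w ω) p := by
    intro β hβ
    refine (hwInt.const_mul (Real.exp (β * M))).mono'
      ((hX.const_mul β).exp.mul hw).aestronglyMeasurable ?_
    filter_upwards [hXM] with ω h
    rw [Real.norm_of_nonneg (hnn β ω)]
    exact mul_le_mul_of_nonneg_right
      (Real.exp_le_exp.2 (mul_le_mul_of_nonneg_left h hβ)) (hw0 ω)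
  have hlim : Tendsto (fun β : ℝ => (∫ ω, w ω ∂p) / p.real B * Real.exp (-(β * (ε / 2))))
      atTop (nhds 0) := by
    have h1 : Tendsto (fun β : ℝ => Real.exp (-(β * (ε / 2)))) atTop (nhds 0) :=
      Real.tendsto_exp_neg_atTop_nhds_zero.comp (tendsto_id.atTop_mul_const (half_pos hε))
    simpa using h1.const_mul ((∫ ω, w ω ∂p) / p.real B)
  refine squeeze_zero' (Eventually.of_forall fun β =>
    div_nonneg (integral_nonneg (hnn β)) (integral_nonneg (hnn β))) ?_ hlim
  filter_upwards [eventually_ge_atTop (0 : ℝ)] with β hβ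
  have hnum : ∫ ω in A, Real.exp (β * X ω) * w ω ∂p
      ≤ Real.exp (β * (M - ε)) * ∫ ω, w ω ∂p := by
    calc ∫ ω in A, Real.exp (β * X ω) * w ω ∂p
        ≤ ∫ ω in A, Real.exp (β * (M - ε)) * w ω ∂p := by
          refine setIntegral_mono_on (hint β hβ).integrableOn
            (hwInt.const_mul _).integrableOn mA fun ω h => ?_
          exact mul_le_mul_of_nonneg_right
            (Real.exp_le_exp.2 (mul_le_mul_of_nonneg_left (le_of_lt h) hβ)) (hw0 ω)
      _ ≤ ∫ ω, Real.exp (β * (M - ε)) * w ω ∂p :=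
          setIntegral_le_integral (hwInt.const_mul _)
            (Eventually.of_forall fun ω => mul_nonneg (Real.exp_pos _).le (hw0 ω))
      _ = _ := integral_const_mul _ _
  have hden : Real.exp (β * (M - ε / 2)) * p.real B
      ≤ ∫ ω, Real.exp (β * X ω) * w ω ∂p := by
    calc Real.exp (β * (M - ε / 2)) * p.real B
        = ∫ ω in B, Real.exp (β * (M - ε / 2)) ∂p := by
          rw [setIntegral_const, smul_eq_mul, mul_comm]
      _ ≤ ∫ ω in B, Real.exp (β * X ω) * w ω ∂p := by
          refine setIntegral_mono_on (integrable_const _).integrableOn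
            (hint β hβ).integrableOn mB fun ω h => ?_
          exact (Real.exp_le_exp.2 (mul_le_mul_of_nonneg_left (le_of_lt h) hβ)).trans
            (le_mul_of_one_le_right (Real.exp_pos _).le (hw1 ω))
      _ ≤ _ := setIntegral_le_integral (hint β hβ) (Eventually.of_forall (hnn β))
  have hpos : 0 < Real.exp (β * (M - ε / 2)) * p.real B := mul_pos (Real.exp_pos _) hr
  have hW : 0 ≤ ∫ ω, w ω ∂p := integral_nonneg hw0
  refine (div_le_div₀ (mul_nonneg (Real.exp_pos _).le hW) hnum hpos hden).trans (le_of_eq ?_)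
  have he : Real.exp (β * (M - ε))
      = Real.exp (β * (M - ε / 2)) * Real.exp (-(β * (ε / 2))) := by
    rw [← Real.exp_add]; congr 1; ring
  rw [he]
  have := (Real.exp_pos (β * (M - ε / 2))).ne'
  field_simp
end

section
/- Let (Ω, p) be a probability space, X : Ω → ℝ measurable, w : Ω → ℝ measurable with w(ω) ≥ 1 for all ω and ∫ w dp < ∞, and let M, B ∈ ℝ satisfy X ≤ M and M − X ≤ B p-almost everywhere. Then for every ε > 0 with ρ_ε := p({ω : X(ω) > M − ε/2}) > 0 and every β ≥ 0, E_{q_β}[M − X] ≤ ε + B·e^{−β·ε/2}·(∫ w dp)/ρ_ε. -/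
open MeasureTheory Real

/-- With `E_{q_β}[f] = (∫ f·exp(β·X)·w dp)/Z_β`, if `X ≤ M` and
`M − X ≤ B` p-a.e., then for every `ε > 0` with `ρ_ε := p({X > M − ε/2}) > 0` and
every `β ≥ 0`, `E_{q_β}[M − X] ≤ ε + B·e^{−β·ε/2}·(∫ w dp)/ρ_ε`. -/
theorem stmt10 {Ω : Type*} [MeasurableSpace Ω] (p : Measure Ω) [IsProbabilityMeasure p]
    (X : Ω → ℝ) (hX : Measurable X) (w : Ω → ℝ) (hw : Measurable w)
    (hw1 : ∀ ω, 1 ≤ w ω) (hwInt : Integrable w p)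
    (M B : ℝ) (hXM : ∀ᵐ ω ∂p, X ω ≤ M) (hB : ∀ᵐ ω ∂p, M - X ω ≤ B)
    (ε : ℝ) (hε : 0 < ε) (hρ : 0 < (p {ω | M - ε / 2 < X ω}).toReal)
    (β : ℝ) (hβ : 0 ≤ β) :
    (∫ ω, (M - X ω) * (Real.exp (β * X ω) * w ω) ∂p) /
        (∫ ω, Real.exp (β * X ω) * w ω ∂p) ≤
      ε + B * Real.exp (-β * ε / 2) * (∫ ω, w ω ∂p) /
        (p {ω | M - ε / 2 < X ω}).toReal := by
  have hB0 : 0 ≤ B := by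
    obtain ⟨ω, h1, h2⟩ := (hXM.and hB).exists
    linarith
  have hw0 : ∀ ω, 0 ≤ w ω := fun ω => le_trans zero_le_one (hw1 ω)
  have hW0 : 0 ≤ ∫ ω, w ω ∂p := integral_nonneg hw0
  have hEm : Measurable fun ω => Real.exp (β * X ω) := by fun_prop
  have hZi : Integrable (fun ω => Real.exp (β * X ω) * w ω) p := by
    refine hwInt.bdd_mul (c := Real.exp (β * M)) hEm.aestronglyMeasurable ?_
    filter_upwards [hXM] with ω h
    rw [Real.norm_eq_abs, abs_of_pos (Real.exp_pos _)]
    exact Real.exp_le_exp.2 (mul_le_mul_of_nonneg_left h hβ)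
  have hNi : Integrable (fun ω => (M - X ω) * (Real.exp (β * X ω) * w ω)) p := by
    refine hZi.bdd_mul (c := B) (by fun_prop) ?_
    filter_upwards [hXM, hB] with ω h h'
    rw [Real.norm_eq_abs, abs_of_nonneg (by linarith)]
    exact h'
  set a := Real.exp (-β * ε / 2) with ha
  set c := Real.exp (β * (M - ε / 2)) with hc
  have ha0 : 0 < a := Real.exp_pos _
  have hc0 : 0 < c := Real.exp_pos _
  have hac : a * c = Real.exp (β * (M - ε)) := by
    rw [ha, hc, ← Real.exp_add]
    congr 1
    ring
  have hN : (∫ ω, (M - X ω) * (Real.exp (β * X ω) * w ω) ∂p) ≤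
      ε * (∫ ω, Real.exp (β * X ω) * w ω ∂p) + B * (a * c) * ∫ ω, w ω ∂p := by
    rw [← integral_const_mul, ← integral_const_mul,
      ← integral_add (hZi.const_mul _) (hwInt.const_mul _)]
    refine integral_mono_ae hNi ((hZi.const_mul _).add (hwInt.const_mul _)) ?_
    filter_upwards [hXM, hB] with ω h h'
    have he : 0 ≤ Real.exp (β * X ω) * w ω := mul_nonneg (Real.exp_pos _).le (hw0 ω)
    have hr : 0 ≤ B * (a * c) * w ω := mul_nonneg (by positivity) (hw0 ω)
    show (M - X ω) * (Real.exp (β * X ω) * w ω) ≤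
      ε * (Real.exp (β * X ω) * w ω) + B * (a * c) * w ω
    rcases le_total (M - X ω) ε with hle | hle
    · have := mul_le_mul_of_nonneg_right hle he
      linarith
    · have h1 : Real.exp (β * X ω) ≤ a * c := by
        rw [hac]
        exact Real.exp_le_exp.2 (mul_le_mul_of_nonneg_left (by linarith) hβ)
      have h2 := mul_le_mul_of_nonneg_right h' he
      have h3 := mul_le_mul_of_nonneg_left (mul_le_mul_of_nonneg_right h1 (hw0 ω)) hB0
      have h4 := mul_nonneg hε.le he
      linarith
  have hZ : c * (p {ω | M - ε / 2 < X ω}).toReal ≤ ∫ ω, Real.exp (β * X ω) * w ω ∂p := by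
    have hS : MeasurableSet {ω | M - ε / 2 < X ω} := measurableSet_lt measurable_const hX
    have h1 : c * (p {ω | M - ε / 2 < X ω}).toReal =
        ∫ ω, ({ω | M - ε / 2 < X ω}).indicator (fun _ => c) ω ∂p := by
      rw [integral_indicator_const _ hS, smul_eq_mul, mul_comm]
      rfl
    rw [h1]
    refine integral_mono ((integrable_const c).indicator hS) hZi ?_
    intro ω
    have he := Real.exp_pos (β * X ω)
    by_cases h : ω ∈ {ω | M - ε / 2 < X ω}
    · rw [Set.indicator_of_mem h]
      have h2 : c ≤ Real.exp (β * X ω) :=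
        Real.exp_le_exp.2 (mul_le_mul_of_nonneg_left (le_of_lt h) hβ)
      exact h2.trans (le_mul_of_one_le_right he.le (hw1 ω))
    · rw [Set.indicator_of_notMem h]
      exact mul_nonneg he.le (hw0 ω)
  set ρ := (p {ω | M - ε / 2 < X ω}).toReal
  have hZ0 := (mul_pos hc0 hρ).trans_le hZ
  rw [div_le_iff₀ hZ0]
  refine hN.trans ?_
  rw [add_mul]
  have h5 := mul_le_mul_of_nonneg_left hZ
    (show 0 ≤ B * a * (∫ ω, w ω ∂p) / ρ by positivity)
  have h6 : B * a * (∫ ω, w ω ∂p) / ρ * (c * ρ) = B * (a * c) * ∫ ω, w ω ∂p := by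
    field_simp
  linarith
end

section
/- Let τ > 0. Let (Ω, p) be a probability space, X : Ω → ℝ measurable with −1/τ ≤ X ≤ M ≤ 1/τ p-almost everywhere for a real number M, and w : Ω → ℝ measurable with w(ω) ≥ 1 for all ω and ∫ w dp < ∞. Suppose p({ω : X(ω) > M − δ}) > 0 for every δ > 0. Then E_{q_β}[exp(X)] → exp(M) as β → ∞. -/
open MeasureTheory Real Filter

/-- Let `τ > 0`, `X : Ω → ℝ` measurable with `−1/τ ≤ X ≤ M ≤ 1/τ`
p-a.e. for a real number `M`, `w ≥ 1` with `∫ w dp < ∞`. If `p({X > M − δ}) > 0`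
for every `δ > 0`, then `E_{q_β}[exp(X)] → exp(M)` as `β → ∞`. -/
theorem stmt12 {Ω : Type*} [MeasurableSpace Ω] (p : Measure Ω) [IsProbabilityMeasure p]
    (τ : ℝ) (hτ : 0 < τ)
    (X : Ω → ℝ) (hX : Measurable X) (M : ℝ)
    (hXlb : ∀ᵐ ω ∂p, -(1 / τ) ≤ X ω) (hXM : ∀ᵐ ω ∂p, X ω ≤ M) (hM : M ≤ 1 / τ)
    (w : Ω → ℝ) (hw : Measurable w) (hw1 : ∀ ω, 1 ≤ w ω) (hwInt : Integrable w p)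
    (hess : ∀ δ : ℝ, 0 < δ → 0 < p {ω | M - δ < X ω}) :
    Tendsto (fun β : ℝ =>
        (∫ ω, Real.exp (X ω) * (Real.exp (β * X ω) * w ω) ∂p) /
          (∫ ω, Real.exp (β * X ω) * w ω ∂p))
      atTop (nhds (Real.exp M)) := by
  have hEint : ∀ β : ℝ, 0 ≤ β → Integrable (fun ω => Real.exp (β * X ω) * w ω) p := by
    intro β hβ
    refine Integrable.mono' (hwInt.const_mul (Real.exp (β * M))) (by fun_prop) ?_
    filter_upwards [hXM] with ω h
    have h1 : 0 ≤ w ω := zero_le_one.trans (hw1 ω)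
    rw [Real.norm_of_nonneg (by positivity)]
    gcongr
  have hNint : ∀ β : ℝ, 0 ≤ β →
      Integrable (fun ω => Real.exp (X ω) * (Real.exp (β * X ω) * w ω)) p := by
    intro β hβ
    refine Integrable.mono' ((hEint β hβ).const_mul (Real.exp M)) (by fun_prop) ?_
    filter_upwards [hXM] with ω h
    have h1 : 0 ≤ w ω := zero_le_one.trans (hw1 ω)
    rw [Real.norm_of_nonneg (by positivity)]
    gcongr
  have hZ : ∀ δ : ℝ, 0 < δ → ∀ β : ℝ, 0 ≤ β →
      Real.exp (β * (M - δ)) * p.real {ω | M - δ < X ω} ≤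
        ∫ ω, Real.exp (β * X ω) * w ω ∂p := by
    intro δ hδ β hβ
    have hm : MeasurableSet {ω | M - δ < X ω} := measurableSet_lt measurable_const hX
    have h0 : ∫ ω, Set.indicator {ω | M - δ < X ω} (fun _ => Real.exp (β * (M - δ))) ω ∂p
        = Real.exp (β * (M - δ)) * p.real {ω | M - δ < X ω} := by
      rw [integral_indicator_const _ hm, smul_eq_mul, mul_comm]
    rw [← h0]
    refine integral_mono ((integrable_const _).indicator hm) (hEint β hβ) ?_
    intro ω
    have h1 : 0 ≤ w ω := zero_le_one.trans (hw1 ω)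
    by_cases h : M - δ < X ω
    · simp only [Set.indicator, Set.mem_setOf_eq, h, if_true]
      calc Real.exp (β * (M - δ)) ≤ Real.exp (β * X ω) := by gcongr
        _ ≤ Real.exp (β * X ω) * w ω := le_mul_of_one_le_right (Real.exp_pos _).le (hw1 ω)
    · simp only [Set.indicator, Set.mem_setOf_eq, h, if_false]
      positivity
  have hc : ∀ δ : ℝ, 0 < δ → 0 < p.real {ω | M - δ < X ω} := fun δ hδ =>
    ENNReal.toReal_pos (hess δ hδ).ne' (measure_ne_top _ _)
  have hZpos : ∀ β : ℝ, 0 ≤ β → 0 < ∫ ω, Real.exp (β * X ω) * w ω ∂p := fun β hβ =>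
    lt_of_lt_of_le (mul_pos (Real.exp_pos _) (hc 1 one_pos)) (hZ 1 one_pos β hβ)
  have hW : 0 ≤ ∫ ω, w ω ∂p := integral_nonneg fun ω => zero_le_one.trans (hw1 ω)
  rw [tendsto_order]
  constructor
  · intro a ha
    obtain ⟨δ, hδ, haδ⟩ : ∃ δ : ℝ, 0 < δ ∧ a < Real.exp (M - 2 * δ) := by
      have ht : Tendsto (fun δ : ℝ => Real.exp (M - 2 * δ)) (nhdsWithin 0 (Set.Ioi 0))
          (nhds (Real.exp M)) := by
        have : Continuous (fun δ : ℝ => Real.exp (M - 2 * δ)) := by fun_prop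
        have h := this.tendsto 0
        simp only [mul_zero, sub_zero] at h
        exact h.mono_left nhdsWithin_le_nhds
      obtain ⟨δ, h1, h2⟩ := ((ht.eventually (lt_mem_nhds ha)).and self_mem_nhdsWithin).exists
      exact ⟨δ, h2, h1⟩
    set c := p.real {ω | M - δ < X ω} with hcdef
    have hcp : 0 < c := hc δ hδ
    set W := ∫ ω, w ω ∂p with hWdef
    have hlim : Tendsto (fun β : ℝ => Real.exp (M - 2 * δ) * (1 - Real.exp (-(β * δ)) * (W / c)))
        atTop (nhds (Real.exp (M - 2 * δ))) := by
      have h1 : Tendsto (fun β : ℝ => Real.exp (-(β * δ))) atTop (nhds 0) :=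
        Real.tendsto_exp_neg_atTop_nhds_zero.comp (tendsto_id.atTop_mul_const hδ)
      have h2 := ((h1.mul_const (W / c)).const_sub 1).const_mul (Real.exp (M - 2 * δ))
      simpa using h2
    filter_upwards [hlim.eventually (lt_mem_nhds haδ), eventually_ge_atTop 0] with β h1 hβ
    refine h1.trans_le ?_
    have hZp := hZpos β hβ
    have hZl := hZ δ hδ β hβ
    rw [le_div_iff₀ hZp]
    have hN : Real.exp (M - 2 * δ) *
        ((∫ ω, Real.exp (β * X ω) * w ω ∂p) - Real.exp (β * (M - 2 * δ)) * W) ≤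
        ∫ ω, Real.exp (X ω) * (Real.exp (β * X ω) * w ω) ∂p := by
      rw [hWdef, ← integral_const_mul, ← integral_sub (hEint β hβ) (hwInt.const_mul _),
        ← integral_const_mul]
      refine integral_mono (((hEint β hβ).sub (hwInt.const_mul _)).const_mul _)
        (hNint β hβ) ?_
      intro ω
      have h1 : 0 ≤ w ω := zero_le_one.trans (hw1 ω)
      simp only
      rcases le_total (M - 2 * δ) (X ω) with h | h
      · have h2 : 0 ≤ Real.exp (β * (M - 2 * δ)) * w ω := by positivity
        calc _ ≤ Real.exp (M - 2 * δ) * (Real.exp (β * X ω) * w ω) := by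
              gcongr
              linarith
          _ ≤ _ := by gcongr
      · have h2 : Real.exp (β * X ω) * w ω ≤ Real.exp (β * (M - 2 * δ)) * w ω := by gcongr
        have h3 : 0 ≤ Real.exp (X ω) * (Real.exp (β * X ω) * w ω) := by positivity
        exact (mul_nonpos_of_nonneg_of_nonpos (Real.exp_pos _).le (by linarith)).trans h3
    refine le_trans ?_ hN
    rw [mul_assoc]
    refine mul_le_mul_of_nonneg_left ?_ (Real.exp_pos _).le
    have h4 : Real.exp (β * (M - 2 * δ)) * W =
        Real.exp (-(β * δ)) * (W / c) * (Real.exp (β * (M - δ)) * c) := by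
      have : β * (M - 2 * δ) = -(β * δ) + β * (M - δ) := by ring
      rw [this, Real.exp_add]
      field_simp
    have h5 : Real.exp (β * (M - 2 * δ)) * W ≤
        Real.exp (-(β * δ)) * (W / c) * ∫ ω, Real.exp (β * X ω) * w ω ∂p := by
      rw [h4]
      exact mul_le_mul_of_nonneg_left hZl (by positivity)
    linarith
  · intro b hb
    filter_upwards [eventually_ge_atTop 0] with β hβ
    refine lt_of_le_of_lt ?_ hb
    rw [div_le_iff₀ (hZpos β hβ), ← integral_const_mul]
    refine integral_mono_ae (hNint β hβ) ((hEint β hβ).const_mul _) ?_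
    filter_upwards [hXM] with ω h
    have h1 : 0 ≤ w ω := zero_le_one.trans (hw1 ω)
    gcongr
end

section
/- Let τ > 0, Q̄ > 0, and a ∈ [e^{−1/τ}, e^{1/τ}]. Let (Ω, p) be a probability space, X : Ω → ℝ measurable with −1/τ ≤ X ≤ M ≤ 1/τ p-almost everywhere for a real number M, and w : Ω → ℝ measurable with w(ω) ≥ 1 for all ω and ∫ w dp < ∞. Then for every β ≥ 0, |log(a + Q̄·E_{q_β}[exp(X)]) − log(a + Q̄·exp(M))| ≤ e^{2/τ}·E_{q_β}[M − X]. -/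
open MeasureTheory Real

/-- Let `τ > 0`, `Q̄ > 0`, `a ∈ [e^{−1/τ}, e^{1/τ}]`, and
`−1/τ ≤ X ≤ M ≤ 1/τ` p-a.e. Then for every `β ≥ 0`,
`|log(a + Q̄·E_{q_β}[exp(X)]) − log(a + Q̄·exp(M))| ≤ e^{2/τ}·E_{q_β}[M − X]`. -/
theorem stmt13 {Ω : Type*} [MeasurableSpace Ω] (p : Measure Ω) [IsProbabilityMeasure p]
    (τ Q a : ℝ) (hτ : 0 < τ) (hQ : 0 < Q)
    (ha₁ : Real.exp (-(1 / τ)) ≤ a) (ha₂ : a ≤ Real.exp (1 / τ))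
    (X : Ω → ℝ) (hX : Measurable X) (M : ℝ)
    (hXlb : ∀ᵐ ω ∂p, -(1 / τ) ≤ X ω) (hXM : ∀ᵐ ω ∂p, X ω ≤ M) (hM : M ≤ 1 / τ)
    (w : Ω → ℝ) (hw : Measurable w) (hw1 : ∀ ω, 1 ≤ w ω) (hwInt : Integrable w p)
    (β : ℝ) (hβ : 0 ≤ β) :
    |Real.log (a + Q * ((∫ ω, Real.exp (X ω) * (Real.exp (β * X ω) * w ω) ∂p) /
          (∫ ω, Real.exp (β * X ω) * w ω ∂p))) -
        Real.log (a + Q * Real.exp M)| ≤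
      Real.exp (2 / τ) *
        ((∫ ω, (M - X ω) * (Real.exp (β * X ω) * w ω) ∂p) /
          (∫ ω, Real.exp (β * X ω) * w ω ∂p)) := by
  have hh : Integrable (fun ω => Real.exp (β * X ω) * w ω) p := by
    refine (hwInt.const_mul (Real.exp (β * M))).mono' (by fun_prop) ?_
    filter_upwards [hXM] with ω h
    have h0 : 0 ≤ w ω := by linarith [hw1 ω]
    rw [Real.norm_of_nonneg (by positivity)]
    gcongr
  have h1 : Integrable (fun ω => Real.exp (X ω) * (Real.exp (β * X ω) * w ω)) p := by
    refine (hh.const_mul (Real.exp M)).mono' (by fun_prop) ?_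
    filter_upwards [hXM] with ω h
    have h0 : 0 ≤ w ω := by linarith [hw1 ω]
    rw [Real.norm_of_nonneg (by positivity)]
    gcongr
  have h2 : Integrable (fun ω => (M - X ω) * (Real.exp (β * X ω) * w ω)) p := by
    refine (hh.const_mul (M + 1 / τ)).mono' (by fun_prop) ?_
    filter_upwards [hXM, hXlb] with ω h h'
    have h0 : 0 ≤ w ω := by linarith [hw1 ω]
    have h3 : 0 ≤ M - X ω := by linarith
    rw [Real.norm_of_nonneg (by positivity)]
    gcongr
    linarith
  have hZ : Real.exp (β * (-(1 / τ))) ≤ ∫ ω, Real.exp (β * X ω) * w ω ∂p := by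
    have : ∫ _ω, Real.exp (β * (-(1 / τ))) ∂p ≤ ∫ ω, Real.exp (β * X ω) * w ω ∂p := by
      refine integral_mono_ae (integrable_const _) hh ?_
      filter_upwards [hXlb] with ω h
      have h4 : Real.exp (β * (-(1 / τ))) ≤ Real.exp (β * X ω) := by gcongr
      have h5 := Real.exp_pos (β * X ω)
      have h6 := hw1 ω
      show Real.exp (β * (-(1 / τ))) ≤ Real.exp (β * X ω) * w ω
      nlinarith
    simpa using this
  have hI1 : ∫ ω, Real.exp (X ω) * (Real.exp (β * X ω) * w ω) ∂p
      ≤ Real.exp M * ∫ ω, Real.exp (β * X ω) * w ω ∂p := by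
    rw [← integral_const_mul]
    refine integral_mono_ae h1 (hh.const_mul _) ?_
    filter_upwards [hXM] with ω h
    have h0 : 0 ≤ w ω := by linarith [hw1 ω]
    gcongr
  have hI2 : Real.exp (-(1 / τ)) * ∫ ω, Real.exp (β * X ω) * w ω ∂p
      ≤ ∫ ω, Real.exp (X ω) * (Real.exp (β * X ω) * w ω) ∂p := by
    rw [← integral_const_mul]
    refine integral_mono_ae (hh.const_mul _) h1 ?_
    filter_upwards [hXlb] with ω h
    have h0 : 0 ≤ w ω := by linarith [hw1 ω]
    gcongr
  have hI3 : Real.exp M * (∫ ω, Real.exp (β * X ω) * w ω ∂p)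
      ≤ (∫ ω, Real.exp (X ω) * (Real.exp (β * X ω) * w ω) ∂p)
        + Real.exp M * ∫ ω, (M - X ω) * (Real.exp (β * X ω) * w ω) ∂p := by
    rw [← integral_const_mul, ← integral_const_mul, ← integral_add h1 (h2.const_mul _)]
    refine integral_mono_ae (hh.const_mul _) (h1.add (h2.const_mul _)) ?_
    filter_upwards with ω
    have h0 : 0 ≤ Real.exp (β * X ω) * w ω :=
      mul_nonneg (Real.exp_pos _).le (by linarith [hw1 ω])
    have h3 : Real.exp M * (X ω - M + 1) ≤ Real.exp (X ω) := by
      have h4 := Real.add_one_le_exp (X ω - M)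
      have h5 : Real.exp (X ω) = Real.exp M * Real.exp (X ω - M) := by
        rw [← Real.exp_add]; congr 1; ring
      rw [h5]
      gcongr
    have := mul_le_mul_of_nonneg_right h3 h0
    linarith
  have hZ0 := (Real.exp_pos _).trans_le hZ
  generalize (∫ ω, Real.exp (β * X ω) * w ω ∂p) = Z at *
  generalize (∫ ω, Real.exp (X ω) * (Real.exp (β * X ω) * w ω) ∂p) = I at *
  generalize (∫ ω, (M - X ω) * (Real.exp (β * X ω) * w ω) ∂p) = J at *
  have e1 : I / Z ≤ Real.exp M := by rwa [div_le_iff₀ hZ0]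
  have e2 : Real.exp (-(1 / τ)) ≤ I / Z := by rwa [le_div_iff₀ hZ0]
  have e3 : Real.exp M - I / Z ≤ Real.exp M * (J / Z) := by
    have : Real.exp M - I / Z = (Real.exp M * Z - I) / Z := by field_simp
    rw [this, ← mul_div_assoc]
    gcongr
    linarith
  generalize I / Z = E at *
  generalize J / Z = D at *
  have hm := Real.exp_pos (-(1 / τ))
  have hE : 0 < E := by linarith
  have ha : 0 < a := by linarith
  have hMp := Real.exp_pos M
  have hA : 0 < a + Q * E := by positivity
  have hB : 0 < a + Q * Real.exp M := by positivity
  have hD : 0 ≤ D := by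
    by_contra hc
    push Not at hc
    nlinarith
  have hle : Real.log (a + Q * E) ≤ Real.log (a + Q * Real.exp M) := by
    apply Real.log_le_log hA
    gcongr
  rw [abs_of_nonpos (by linarith), neg_sub, ← Real.log_div hB.ne' hA.ne']
  refine (Real.log_le_sub_one_of_pos (by positivity)).trans ?_
  have k : (a + Q * Real.exp M) / (a + Q * E) - 1
      = Q * (Real.exp M - E) / (a + Q * E) := by field_simp; ring
  rw [k, div_le_iff₀ hA]
  have k2 : Real.exp M ≤ Real.exp (2 / τ) * E := by
    calc Real.exp M ≤ Real.exp (1 / τ) := by gcongr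
      _ = Real.exp (2 / τ) * Real.exp (-(1 / τ)) := by
        rw [← Real.exp_add]; congr 1; ring
      _ ≤ _ := by gcongr
  have hT := Real.exp_pos (2 / τ)
  calc Q * (Real.exp M - E) ≤ Q * (Real.exp M * D) := by gcongr
    _ ≤ Q * ((Real.exp (2 / τ) * E) * D) := by gcongr
    _ = Real.exp (2 / τ) * D * (Q * E) := by ring
    _ ≤ Real.exp (2 / τ) * D * (a + Q * E) := by
      gcongr
      linarith
end

section
/- Let τ > 0, Q̄ > 0, and a ∈ [e^{−1/τ}, e^{1/τ}]. Let (Ω, p) be a probability space, X : Ω → ℝ measurable with −1/τ ≤ X ≤ M ≤ 1/τ p-almost everywhere for a real number M, and w : Ω → ℝ measurable with w(ω) ≥ 1 for all ω and ∫ w dp < ∞. Suppose p({ω : X(ω) > M − δ}) > 0 for every δ > 0. Then the per-anchor contrastive loss −log(a/(a + Q̄·E_{q_β}[exp(X)])) converges, as β → ∞, to the worst-case per-anchor loss −log(a/(a + Q̄·exp(M))). -/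
open MeasureTheory Real Filter

/-- Under the same assumptions, if moreover `p({X > M − δ}) > 0` for
every `δ > 0`, then the per-anchor contrastive loss
`−log(a/(a + Q̄·E_{q_β}[exp(X)]))` converges, as `β → ∞`, to the worst-case
per-anchor loss `−log(a/(a + Q̄·exp(M)))`. -/
theorem stmt14 {Ω : Type*} [MeasurableSpace Ω] (p : Measure Ω) [IsProbabilityMeasure p]
    (τ Q a : ℝ) (hτ : 0 < τ) (hQ : 0 < Q)
    (ha₁ : Real.exp (-(1 / τ)) ≤ a) (ha₂ : a ≤ Real.exp (1 / τ))
    (X : Ω → ℝ) (hX : Measurable X) (M : ℝ)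
    (hXlb : ∀ᵐ ω ∂p, -(1 / τ) ≤ X ω) (hXM : ∀ᵐ ω ∂p, X ω ≤ M) (hM : M ≤ 1 / τ)
    (w : Ω → ℝ) (hw : Measurable w) (hw1 : ∀ ω, 1 ≤ w ω) (hwInt : Integrable w p)
    (hess : ∀ δ : ℝ, 0 < δ → 0 < p {ω | M - δ < X ω}) :
    Tendsto (fun β : ℝ =>
        -Real.log (a / (a + Q * ((∫ ω, Real.exp (X ω) * (Real.exp (β * X ω) * w ω) ∂p) /
          (∫ ω, Real.exp (β * X ω) * w ω ∂p)))))
      atTop (nhds (-Real.log (a / (a + Q * Real.exp M)))) := by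
  have hapos : 0 < a := lt_of_lt_of_le (Real.exp_pos _) ha₁
  have hw0 : ∀ ω, 0 < w ω := fun ω => lt_of_lt_of_le one_pos (hw1 ω)
  have hZint : ∀ β : ℝ, 0 ≤ β → Integrable (fun ω => Real.exp (β * X ω) * w ω) p := by
    intro β hβ
    refine Integrable.mono' (hwInt.const_mul (Real.exp (β * M))) (by fun_prop) ?_
    filter_upwards [hXM] with ω h
    have := hw0 ω
    rw [Real.norm_of_nonneg (by positivity)]
    gcongr
  have hNint : ∀ β : ℝ, 0 ≤ β →
      Integrable (fun ω => Real.exp (X ω) * (Real.exp (β * X ω) * w ω)) p := by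
    intro β hβ
    refine Integrable.mono' ((hZint β hβ).const_mul (Real.exp M)) (by fun_prop) ?_
    filter_upwards [hXM] with ω h
    have := hw0 ω
    rw [Real.norm_of_nonneg (by positivity)]
    gcongr
  have hZlb : ∀ β : ℝ, 0 ≤ β → ∀ δ : ℝ, 0 < δ →
      Real.exp (β * (M - δ)) * p.real {ω | M - δ < X ω} ≤
        ∫ ω, Real.exp (β * X ω) * w ω ∂p := by
    intro β hβ δ hδ
    refine le_trans ?_ (mul_meas_ge_le_integral_of_nonneg (ae_of_all _ fun ω => ?_)
      (hZint β hβ) (Real.exp (β * (M - δ))))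
    · gcongr
      · exact measure_ne_top _ _
      · rename_i ω
        intro h
        have h1 : Real.exp (β * (M - δ)) ≤ Real.exp (β * X ω) := by
          gcongr
        exact h1.trans (le_mul_of_one_le_right (Real.exp_pos _).le (hw1 ω))
    · exact (mul_pos (Real.exp_pos _) (hw0 ω)).le
  have hm : ∀ δ : ℝ, 0 < δ → 0 < p.real {ω | M - δ < X ω} := fun δ hδ =>
    ENNReal.toReal_pos (hess δ hδ).ne' (measure_ne_top _ _)
  have hZpos : ∀ β : ℝ, 0 ≤ β → 0 < ∫ ω, Real.exp (β * X ω) * w ω ∂p := fun β hβ =>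
    lt_of_lt_of_le (mul_pos (Real.exp_pos _) (hm 1 one_pos)) (hZlb β hβ 1 one_pos)
  have hW : 0 ≤ ∫ ω, w ω ∂p := integral_nonneg fun ω => (hw0 ω).le
  have key : Tendsto (fun β : ℝ => (∫ ω, Real.exp (X ω) * (Real.exp (β * X ω) * w ω) ∂p) /
          (∫ ω, Real.exp (β * X ω) * w ω ∂p)) atTop (nhds (Real.exp M)) := by
    refine tendsto_order.2 ⟨fun c hc => ?_, fun c hc => ?_⟩
    · obtain ⟨δ, hδ, hcδ⟩ : ∃ δ : ℝ, 0 < δ ∧ c < Real.exp (M - 2 * δ) := by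
        have hcont : Tendsto (fun δ : ℝ => Real.exp (M - 2 * δ)) (nhdsWithin 0 (Set.Ioi 0))
            (nhds (Real.exp M)) := by
          have : Continuous (fun δ : ℝ => Real.exp (M - 2 * δ)) := by fun_prop
          have h := this.tendsto 0
          simp only [mul_zero, sub_zero] at h
          exact h.mono_left nhdsWithin_le_nhds
        obtain ⟨δ, h1, h2⟩ := ((hcont.eventually (lt_mem_nhds hc)).and
          self_mem_nhdsWithin).exists
        exact ⟨δ, h2, h1⟩
      have hlim : Tendsto (fun β : ℝ => Real.exp (M - 2 * δ) -
          Real.exp M * (∫ ω, w ω ∂p) / p.real {ω | M - δ < X ω} * Real.exp (-(β * δ)))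
          atTop (nhds (Real.exp (M - 2 * δ))) := by
        have h1 : Tendsto (fun β : ℝ => Real.exp (-(β * δ))) atTop (nhds 0) :=
          Real.tendsto_exp_neg_atTop_nhds_zero.comp (tendsto_id.atTop_mul_const hδ)
        simpa using (h1.const_mul
          (Real.exp M * (∫ ω, w ω ∂p) / p.real {ω | M - δ < X ω})).const_sub
            (Real.exp (M - 2 * δ))
      filter_upwards [hlim.eventually (lt_mem_nhds hcδ), eventually_ge_atTop 0] with β hβc hβ
      refine hβc.trans_le ?_
      rw [le_div_iff₀ (hZpos β hβ)]
      have hpt : Real.exp (M - 2 * δ) * (∫ ω, Real.exp (β * X ω) * w ω ∂p) -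
          Real.exp M * Real.exp (β * (M - 2 * δ)) * (∫ ω, w ω ∂p) ≤
          ∫ ω, Real.exp (X ω) * (Real.exp (β * X ω) * w ω) ∂p := by
        rw [← integral_const_mul, ← integral_const_mul, ← integral_sub
          ((hZint β hβ).const_mul _) (hwInt.const_mul _)]
        refine integral_mono (((hZint β hβ).const_mul _).sub (hwInt.const_mul _))
          (hNint β hβ) fun ω => ?_
        have := hw0 ω
        simp only
        rcases le_total (M - 2 * δ) (X ω) with h | h
        · have h1 : Real.exp (M - 2 * δ) * (Real.exp (β * X ω) * w ω) ≤
              Real.exp (X ω) * (Real.exp (β * X ω) * w ω) := by gcongr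
          have h2 : 0 ≤ Real.exp M * Real.exp (β * (M - 2 * δ)) * w ω := by positivity
          linarith
        · have h1 : Real.exp (M - 2 * δ) * (Real.exp (β * X ω) * w ω) ≤
              Real.exp M * (Real.exp (β * (M - 2 * δ)) * w ω) := by
            gcongr
            linarith
          have h2 : 0 ≤ Real.exp (X ω) * (Real.exp (β * X ω) * w ω) := by positivity
          linarith
      refine le_trans ?_ hpt
      have hmδ := hm δ hδ
      have h3 : Real.exp M * Real.exp (β * (M - 2 * δ)) * (∫ ω, w ω ∂p) =
          Real.exp M * (∫ ω, w ω ∂p) / p.real {ω | M - δ < X ω} * Real.exp (-(β * δ)) *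
          (Real.exp (β * (M - δ)) * p.real {ω | M - δ < X ω}) := by
        have : Real.exp (β * (M - 2 * δ)) = Real.exp (-(β * δ)) * Real.exp (β * (M - δ)) := by
          rw [← Real.exp_add]; congr 1; ring
        rw [this]
        field_simp
      have h4 := mul_le_mul_of_nonneg_left (hZlb β hβ δ hδ)
        (show 0 ≤ Real.exp M * (∫ ω, w ω ∂p) / p.real {ω | M - δ < X ω} *
          Real.exp (-(β * δ)) by positivity)
      rw [h3, sub_mul]
      linarith
    · filter_upwards [eventually_ge_atTop 0] with β hβ
      refine lt_of_le_of_lt ?_ hc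
      rw [div_le_iff₀ (hZpos β hβ), ← integral_const_mul]
      refine integral_mono_ae (hNint β hβ) ((hZint β hβ).const_mul _) ?_
      filter_upwards [hXM] with ω h
      have := hw0 ω
      gcongr
  have hden : 0 < a + Q * Real.exp M := by positivity
  exact ((tendsto_const_nhds.div ((key.const_mul Q).const_add a) hden.ne').log
    (div_pos hapos hden).ne').neg
end

section
/- Let τ > 0 and Q̄ > 0. Let (𝒳, μ) and (Ω, p) be probability spaces, let a : 𝒳 → ℝ be measurable with a(x) ∈ [e^{−1/τ}, e^{1/τ}] for all x, and let s : 𝒳 × Ω → ℝ be jointly measurable with −1/τ ≤ s(x, ω) ≤ 1/τ for all (x, ω). Let w : Ω → ℝ be measurable with w(ω) ≥ 1 for all ω and ∫ w dp < ∞. For each x let M(x) denote the essential supremum of s(x, ·) with respect to p, and assume x ↦ M(x) is measurable. For β ≥ 0 define the per-anchor tilted expectation T_β(x) = (∫ exp(s(x,ω))·exp(β·s(x,ω))·w(ω) dp(ω)) / (∫ exp(β·s(x,ω))·w(ω) dp(ω)), the loss L(β) = ∫ −log( a(x)/(a(x) + Q̄·T_β(x)) ) dμ(x), and the worst-case loss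 L̄ = ∫ −log( a(x)/(a(x) + Q̄·exp(M(x))) ) dμ(x). Then |L̄ − L(β)| → 0 as β → ∞. -/
open MeasureTheory Real Filter

lemma tilt_integrable {Ω : Type*} [MeasurableSpace Ω] (p : Measure Ω) [IsProbabilityMeasure p]
    (C : ℝ) (f : Ω → ℝ) (hf : Measurable f) (h1 : ∀ ω, -C ≤ f ω) (h2 : ∀ ω, f ω ≤ C)
    (w : Ω → ℝ) (hwInt : Integrable w p) (β : ℝ) :
    Integrable (fun ω => Real.exp (β * f ω) * w ω) p := by
  refine hwInt.bdd_mul (c := Real.exp (|β| * C)) (by fun_prop) (ae_of_all _ fun ω => ?_)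
  rw [Real.norm_eq_abs, abs_of_pos (Real.exp_pos _)]
  apply Real.exp_le_exp.2
  refine (le_abs_self _).trans ?_
  rw [abs_mul]
  exact mul_le_mul_of_nonneg_left (abs_le.2 ⟨h1 ω, h2 ω⟩) (abs_nonneg _)

lemma tilt_integrable' {Ω : Type*} [MeasurableSpace Ω] (p : Measure Ω) [IsProbabilityMeasure p]
    (C : ℝ) (f : Ω → ℝ) (hf : Measurable f) (h1 : ∀ ω, -C ≤ f ω) (h2 : ∀ ω, f ω ≤ C)
    (w : Ω → ℝ) (hwInt : Integrable w p) (β : ℝ) :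
    Integrable (fun ω => Real.exp (f ω) * (Real.exp (β * f ω) * w ω)) p := by
  have := tilt_integrable p C f hf h1 h2 w hwInt (1 + β)
  refine this.congr (ae_of_all _ fun ω => ?_)
  simp only [add_mul, one_mul, Real.exp_add, mul_assoc]

lemma tilt_pos {Ω : Type*} [MeasurableSpace Ω] (p : Measure Ω) [IsProbabilityMeasure p]
    (C : ℝ) (f : Ω → ℝ) (hf : Measurable f) (h1 : ∀ ω, -C ≤ f ω) (h2 : ∀ ω, f ω ≤ C)
    (w : Ω → ℝ) (hw1 : ∀ ω, 1 ≤ w ω) (hwInt : Integrable w p) (β : ℝ) :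
    0 < ∫ ω, Real.exp (β * f ω) * w ω ∂p := by
  have hpos : ∀ ω, 0 < Real.exp (β * f ω) * w ω := fun ω =>
    mul_pos (Real.exp_pos _) (by linarith [hw1 ω])
  rw [integral_pos_iff_support_of_nonneg (fun ω => (hpos ω).le)
    (tilt_integrable p C f hf h1 h2 w hwInt β)]
  have : Function.support (fun ω => Real.exp (β * f ω) * w ω) = Set.univ := by
    ext ω; simpa using (hpos ω).ne'
  rw [this]; simp

lemma tilt_le {Ω : Type*} [MeasurableSpace Ω] (p : Measure Ω) [IsProbabilityMeasure p]
    (C : ℝ) (f : Ω → ℝ) (hf : Measurable f) (h1 : ∀ ω, -C ≤ f ω) (h2 : ∀ ω, f ω ≤ C)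
    (w : Ω → ℝ) (hw1 : ∀ ω, 1 ≤ w ω) (hwInt : Integrable w p) (β K : ℝ)
    (hK : ∀ᵐ ω ∂p, f ω ≤ K) :
    (∫ ω, Real.exp (f ω) * (Real.exp (β * f ω) * w ω) ∂p) /
      (∫ ω, Real.exp (β * f ω) * w ω ∂p) ≤ Real.exp K := by
  rw [div_le_iff₀ (tilt_pos p C f hf h1 h2 w hw1 hwInt β), ← integral_const_mul]
  refine integral_mono_ae (tilt_integrable' p C f hf h1 h2 w hwInt β)
    ((tilt_integrable p C f hf h1 h2 w hwInt β).const_mul _) ?_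
  filter_upwards [hK] with ω h
  exact mul_le_mul_of_nonneg_right (Real.exp_le_exp.2 h)
    (mul_nonneg (Real.exp_pos _).le (by linarith [hw1 ω]))

lemma tilt_nonneg {Ω : Type*} [MeasurableSpace Ω] (p : Measure Ω)
    (f : Ω → ℝ) (w : Ω → ℝ) (hw1 : ∀ ω, 1 ≤ w ω) (β : ℝ) :
    0 ≤ (∫ ω, Real.exp (f ω) * (Real.exp (β * f ω) * w ω) ∂p) /
      (∫ ω, Real.exp (β * f ω) * w ω ∂p) := by
  have h : ∀ ω, 0 ≤ w ω := fun ω => by linarith [hw1 ω]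
  refine div_nonneg (integral_nonneg fun ω => ?_) (integral_nonneg fun ω => ?_)
  · exact mul_nonneg (Real.exp_pos _).le (mul_nonneg (Real.exp_pos _).le (h ω))
  · exact mul_nonneg (Real.exp_pos _).le (h ω)

lemma tilt_tendsto {Ω : Type*} [MeasurableSpace Ω] (p : Measure Ω) [IsProbabilityMeasure p]
    (C : ℝ) (f : Ω → ℝ) (hf : Measurable f) (h1 : ∀ ω, -C ≤ f ω) (h2 : ∀ ω, f ω ≤ C)
    (w : Ω → ℝ) (hw1 : ∀ ω, 1 ≤ w ω) (hwInt : Integrable w p) :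
    Tendsto (fun β : ℝ => (∫ ω, Real.exp (f ω) * (Real.exp (β * f ω) * w ω) ∂p) /
      (∫ ω, Real.exp (β * f ω) * w ω ∂p)) atTop (nhds (Real.exp (essSup f p))) := by
  have hbdd : IsBoundedUnder (· ≤ ·) (ae p) f := ⟨C, by simpa using ae_of_all _ h2⟩
  have hbdd' : IsBoundedUnder (· ≥ ·) (ae p) f := ⟨-C, by simpa using ae_of_all _ h1⟩
  have hle : ∀ᵐ ω ∂p, f ω ≤ essSup f p := ae_le_essSup hbdd
  rw [tendsto_order]
  constructor
  · intro c hc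
    have hev : ∀ᶠ m in nhdsWithin (essSup f p) (Set.Iio (essSup f p)), c < Real.exp m :=
      (Real.continuous_exp.tendsto _).mono_left nhdsWithin_le_nhds |>.eventually (lt_mem_nhds hc)
    obtain ⟨m, hcm, hm⟩ := (hev.and self_mem_nhdsWithin).exists
    obtain ⟨m', hmm', hm'⟩ := exists_between (show m < essSup f p from hm)
    have hfreq : ∃ᶠ ω in ae p, m' < f ω :=
      frequently_lt_of_lt_limsup hbdd'.isCoboundedUnder_le hm'
    have hA : MeasurableSet {ω | m' < f ω} := measurableSet_lt measurable_const hf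
    have hP : 0 < p.real {ω | m' < f ω} := by
      rw [frequently_ae_iff] at hfreq
      exact ENNReal.toReal_pos hfreq (measure_ne_top _ _)
    set P := p.real {ω | m' < f ω} with hPdef
    set W := ∫ ω, w ω ∂p with hW
    have hlim : Tendsto (fun β : ℝ => Real.exp m * (1 - Real.exp (-(β * (m' - m))) * (W / P)))
        atTop (nhds (Real.exp m * (1 - 0 * (W / P)))) := by
      refine (((Real.tendsto_exp_neg_atTop_nhds_zero.comp
        (tendsto_id.atTop_mul_const (sub_pos.2 hmm'))).mul_const _).const_sub 1).const_mul _
    have hlim2 := hlim.eventually (lt_mem_nhds (show c < Real.exp m * (1 - 0 * (W / P)) by simpa))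
    filter_upwards [hlim2, eventually_ge_atTop 0] with β hβ hβ0
    refine hβ.trans_le ?_
    have hDpos := tilt_pos p C f hf h1 h2 w hw1 hwInt β
    have hDi := tilt_integrable p C f hf h1 h2 w hwInt β
    have hNi := tilt_integrable' p C f hf h1 h2 w hwInt β
    have hD : Real.exp (β * m') * P ≤ ∫ ω, Real.exp (β * f ω) * w ω ∂p := by
      have : ∫ ω, ({ω | m' < f ω}).indicator (fun _ => Real.exp (β * m')) ω ∂p
          = Real.exp (β * m') * P := by
        rw [integral_indicator_const _ hA, smul_eq_mul, mul_comm]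
      rw [← this]
      refine integral_mono ((integrable_const _).indicator hA) hDi fun ω => ?_
      have h0 : 0 < Real.exp (β * f ω) := Real.exp_pos _
      by_cases h : m' < f ω
      · have : Real.exp (β * m') ≤ Real.exp (β * f ω) :=
          Real.exp_le_exp.2 (mul_le_mul_of_nonneg_left h.le hβ0)
        simp only [Set.indicator, Set.mem_ofPred_eq, h, if_true]
        nlinarith [hw1 ω]
      · simp only [Set.indicator, Set.mem_ofPred_eq, h, if_false]
        nlinarith [hw1 ω]
    have hN : Real.exp m * ((∫ ω, Real.exp (β * f ω) * w ω ∂p) - Real.exp (β * m) * W) ≤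
        ∫ ω, Real.exp (f ω) * (Real.exp (β * f ω) * w ω) ∂p := by
      rw [hW, ← integral_const_mul, ← integral_sub hDi (hwInt.const_mul _), ← integral_const_mul]
      refine integral_mono ((hDi.sub (hwInt.const_mul _)).const_mul _) hNi fun ω => ?_
      have hw0 : 0 < w ω := by linarith [hw1 ω]
      have hx : 0 < Real.exp (β * f ω) * w ω := mul_pos (Real.exp_pos _) hw0
      have hy : 0 < Real.exp (β * m) * w ω := mul_pos (Real.exp_pos _) hw0
      have hem := Real.exp_pos m
      simp only
      rcases le_total m (f ω) with h | h
      · have := Real.exp_le_exp.2 h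
        nlinarith
      · have h3 : Real.exp (β * f ω) * w ω ≤ Real.exp (β * m) * w ω :=
          mul_le_mul_of_nonneg_right
            (Real.exp_le_exp.2 (mul_le_mul_of_nonneg_left h hβ0)) hw0.le
        have h4 : 0 < Real.exp (f ω) * (Real.exp (β * f ω) * w ω) := mul_pos (Real.exp_pos _) hx
        nlinarith
    rw [le_div_iff₀ hDpos]
    refine le_trans ?_ hN
    rw [mul_assoc]
    refine mul_le_mul_of_nonneg_left ?_ (Real.exp_pos _).le
    set D := ∫ ω, Real.exp (β * f ω) * w ω ∂p
    have hW0 : 0 ≤ W := integral_nonneg fun ω => by simpa using (zero_le_one.trans (hw1 ω))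
    have key : Real.exp (β * m) * W =
        Real.exp (-(β * (m' - m))) * (W / P) * (Real.exp (β * m') * P) := by
      have : Real.exp (β * m) = Real.exp (-(β * (m' - m))) * Real.exp (β * m') := by
        rw [← Real.exp_add]; ring_nf
      rw [this]; field_simp
    have := mul_le_mul_of_nonneg_left hD
      (mul_nonneg (Real.exp_pos (-(β * (m' - m)))).le (div_nonneg hW0 hP.le))
    rw [← key] at this
    linarith
  · intro c hc
    exact Eventually.of_forall fun β =>
      (tilt_le p C f hf h1 h2 w hw1 hwInt β _ hle).trans_lt hc


/-- worst-case negative sampling lemma: Let `τ > 0`, `Q̄ > 0`,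
`(𝒳, μ)` and `(Ω, p)` probability spaces, `a : 𝒳 → ℝ` measurable with values in
`[e^{−1/τ}, e^{1/τ}]`, `s : 𝒳 × Ω → ℝ` jointly measurable with values in
`[−1/τ, 1/τ]`, and `w : Ω → ℝ` measurable with `w ≥ 1` and `∫ w dp < ∞`. With
`M(x)` the essential supremum of `s(x, ·)` under `p` (assumed measurable in `x`),
per-anchor tilted expectations `T_β(x)`, loss `L(β)` and worst-case loss `L̄` as in
the paper, `|L̄ − L(β)| → 0` as `β → ∞`. -/
theorem stmt15 {𝒳 Ω : Type*} [MeasurableSpace 𝒳] [MeasurableSpace Ω]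
    (μ : Measure 𝒳) [IsProbabilityMeasure μ] (p : Measure Ω) [IsProbabilityMeasure p]
    (τ Q : ℝ) (hτ : 0 < τ) (hQ : 0 < Q)
    (a : 𝒳 → ℝ) (ha : Measurable a)
    (ha₁ : ∀ x, Real.exp (-(1 / τ)) ≤ a x) (ha₂ : ∀ x, a x ≤ Real.exp (1 / τ))
    (s : 𝒳 → Ω → ℝ) (hs : Measurable (Function.uncurry s))
    (hs₁ : ∀ x ω, -(1 / τ) ≤ s x ω) (hs₂ : ∀ x ω, s x ω ≤ 1 / τ)
    (w : Ω → ℝ) (hw : Measurable w) (hw1 : ∀ ω, 1 ≤ w ω) (hwInt : Integrable w p)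
    (M : 𝒳 → ℝ) (hM : ∀ x, M x = essSup (fun ω => s x ω) p) (hMmeas : Measurable M) :
    Tendsto (fun β : ℝ =>
        |(∫ x, -Real.log (a x / (a x + Q * Real.exp (M x))) ∂μ) -
          (∫ x, -Real.log (a x / (a x + Q *
            ((∫ ω, Real.exp (s x ω) * (Real.exp (β * s x ω) * w ω) ∂p) /
              (∫ ω, Real.exp (β * s x ω) * w ω ∂p)))) ∂μ)|)
      atTop (nhds 0) := by
  have hsx : ∀ x, Measurable (s x) := fun x => hs.comp measurable_prodMk_left
  set T : ℝ → 𝒳 → ℝ := fun β x =>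
    (∫ ω, Real.exp (s x ω) * (Real.exp (β * s x ω) * w ω) ∂p) /
      (∫ ω, Real.exp (β * s x ω) * w ω ∂p) with hT
  have hs' : Measurable fun z : 𝒳 × Ω => s z.1 z.2 := hs
  have hTm : ∀ β, Measurable (T β) := by
    intro β
    refine Measurable.div ?_ ?_
    · have : StronglyMeasurable (Function.uncurry fun x ω =>
          Real.exp (s x ω) * (Real.exp (β * s x ω) * w ω)) := by
        apply Measurable.stronglyMeasurable
        simp only [Function.uncurry_def]
        fun_prop
      exact this.integral_prod_right.measurable
    · have : StronglyMeasurable (Function.uncurry fun x ω =>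
          Real.exp (β * s x ω) * w ω) := by
        apply Measurable.stronglyMeasurable
        simp only [Function.uncurry_def]
        fun_prop
      exact this.integral_prod_right.measurable
  have hT0 : ∀ β x, 0 ≤ T β x := fun β x => tilt_nonneg p (s x) w hw1 β
  have hT1 : ∀ β x, T β x ≤ Real.exp (1 / τ) := fun β x =>
    tilt_le p (1 / τ) (s x) (hsx x) (hs₁ x) (hs₂ x) w hw1 hwInt β _ (ae_of_all _ (hs₂ x))
  have hTl : ∀ x, Tendsto (fun β => T β x) atTop (nhds (Real.exp (M x))) := fun x => by
    rw [hM x]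
    exact tilt_tendsto p (1 / τ) (s x) (hsx x) (hs₁ x) (hs₂ x) w hw1 hwInt
  have ha0 : ∀ x, 0 < a x := fun x => (Real.exp_pos _).trans_le (ha₁ x)
  have main : Tendsto (fun β : ℝ => ∫ x, -Real.log (a x / (a x + Q * T β x)) ∂μ) atTop
      (nhds (∫ x, -Real.log (a x / (a x + Q * Real.exp (M x))) ∂μ)) := by
    refine tendsto_integral_filter_of_dominated_convergence
      (fun _ => Q * Real.exp (1 / τ) / Real.exp (-(1 / τ))) ?_ ?_ (integrable_const _) ?_
    · refine Eventually.of_forall fun β => Measurable.aestronglyMeasurable ?_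
      have := hTm β
      fun_prop
    · refine Eventually.of_forall fun β => ae_of_all _ fun x => ?_
      have h0 := hT0 β x
      have hax := ha0 x
      have hQT : 0 ≤ Q * T β x := mul_nonneg hQ.le h0
      rw [← Real.log_inv, inv_div, add_div, div_self hax.ne']
      have hr : 0 ≤ Q * T β x / a x := div_nonneg hQT hax.le
      rw [Real.norm_eq_abs, abs_of_nonneg (Real.log_nonneg (by linarith))]
      refine (Real.log_le_sub_one_of_pos (by linarith)).trans ?_
      rw [add_sub_cancel_left]
      exact div_le_div₀ (by positivity) (mul_le_mul_of_nonneg_left (hT1 β x) hQ.le)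
        (Real.exp_pos _) (ha₁ x)
    · refine ae_of_all _ fun x => ?_
      have hax := ha0 x
      have hpos : 0 < a x + Q * Real.exp (M x) := by positivity
      have hd := (tendsto_const_nhds (x := a x)).div
        (((hTl x).const_mul Q).const_add (a x)) hpos.ne'
      exact (hd.log (div_pos hax hpos).ne').neg
  have h := (main.const_sub (∫ x, -Real.log (a x / (a x + Q * Real.exp (M x))) ∂μ)).abs
  rwa [sub_self, abs_zero] at h
end
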